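/- Let x, y ∈ [0,1] and let A, B be operators with 0 ≤ A ≤ 1, 0 ≤ B ≤ 1 on a finite-dimensional Hilbert space, and ρ a density matrix with tr(Aρ) = x and tr(Bρ) = y. Then tr(ABρ) ≥ xy − √(x − x²)·√(y − y²). -/

import Mathlib

open scoped ComplexOrder

lemma aux_nonneg {n : Type*} [Fintype n] [DecidableEq n]
    (M ρ : Matrix n n ℂ) (hM : M.PosSemidef) (hρ : ρ.PosSemidef) :
    0 ≤ ((M * ρ).trace).re := by
  obtain ⟨S, rfl⟩ : ∃ S : Matrix n n ℂ, ρ = S.conjTranspose * S := by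
    open scoped MatrixOrder in
    exact CStarAlgebra.nonneg_iff_eq_star_mul_self.mp hρ.nonneg
  have h := (hM.mul_mul_conjTranspose_same S).trace_nonneg
  rw [← Matrix.mul_assoc, Matrix.trace_mul_comm, ← Matrix.mul_assoc]
  exact (Complex.le_def.mp h).1

lemma aux_sq_le {n : Type*} [Fintype n] [DecidableEq n]
    (A ρ : Matrix n n ℂ) (hA : A.PosSemidef) (hA1 : (1 - A).PosSemidef)
    (hρ : ρ.PosSemidef) : ((A * A * ρ).trace).re ≤ ((A * ρ).trace).re := by
  have h1 := hA1.mul_mul_conjTranspose_same A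
  have h2 := hA.mul_mul_conjTranspose_same (1 - A)
  rw [hA.1.eq] at h1
  rw [hA1.1.eq] at h2
  have h := aux_nonneg _ ρ (h1.add h2) hρ
  have e : A * (1 - A) * A + (1 - A) * A * (1 - A) = A - A * A := by noncomm_ring
  rw [e, Matrix.sub_mul, Matrix.trace_sub, Complex.sub_re] at h
  linarith

theorem stmt_17 {n : Type*} [Fintype n] [DecidableEq n]
    (A B ρ : Matrix n n ℂ)
    (hA : A.PosSemidef) (hA1 : (1 - A).PosSemidef)
    (hB : B.PosSemidef) (hB1 : (1 - B).PosSemidef)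
    (hAB : A * B = B * A)
    (hρ : ρ.PosSemidef) (htr : ρ.trace = 1)
    (x y : ℝ) (hx0 : 0 ≤ x) (hx1 : x ≤ 1) (hy0 : 0 ≤ y) (hy1 : y ≤ 1)
    (hx : x = ((A * ρ).trace).re) (hy : y = ((B * ρ).trace).re) :
    x * y - Real.sqrt (x - x ^ 2) * Real.sqrt (y - y ^ 2) ≤
      ((A * B * ρ).trace).re := by
  have ha := aux_sq_le A ρ hA hA1 hρ
  have hb := aux_sq_le B ρ hB hB1 hρ
  rw [← hx] at ha
  rw [← hy] at hb
  have key : ∀ t : ℝ, 0 ≤ (y - y ^ 2) * (t * t)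
      + (2 * (((A * B * ρ).trace).re - x * y)) * t + (x - x ^ 2) := by
    intro t
    have hH : (A + (t : ℂ) • B - ((x + t * y : ℝ) : ℂ) • (1 : Matrix n n ℂ)).IsHermitian := by
      unfold Matrix.IsHermitian
      simp [Matrix.conjTranspose_sub, Matrix.conjTranspose_add, Matrix.conjTranspose_smul,
        hA.1.eq, hB.1.eq]
    have h := aux_nonneg _ ρ (Matrix.posSemidef_self_mul_conjTranspose
      (A + (t : ℂ) • B - ((x + t * y : ℝ) : ℂ) • (1 : Matrix n n ℂ))) hρ
    rw [hH.eq] at h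
    have e : ((((A + (t : ℂ) • B - ((x + t * y : ℝ) : ℂ) • (1 : Matrix n n ℂ)) *
        (A + (t : ℂ) • B - ((x + t * y : ℝ) : ℂ) • (1 : Matrix n n ℂ))) * ρ).trace).re =
        ((A * A * ρ).trace).re + 2 * t * ((A * B * ρ).trace).re
        + t ^ 2 * ((B * B * ρ).trace).re - (x + t * y) ^ 2 := by
      generalize hc : x + t * y = c
      simp only [Matrix.sub_mul, Matrix.mul_sub, Matrix.add_mul, Matrix.mul_add,
        Matrix.smul_mul, Matrix.mul_smul, Matrix.one_mul, Matrix.mul_one, ← hAB,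
        Matrix.trace_add, Matrix.trace_sub, Matrix.trace_smul, smul_eq_mul, htr,
        Complex.add_re, Complex.sub_re, Complex.re_ofReal_mul, ← hx, ← hy, Complex.one_re]
      subst hc
      ring
    rw [e] at h
    nlinarith [mul_nonneg (sq_nonneg t) (sub_nonneg.mpr hb)]
  have hd := discrim_le_zero key
  unfold discrim at hd
  have hxx : 0 ≤ x - x ^ 2 := by nlinarith
  have h2 : (x * y - ((A * B * ρ).trace).re) ^ 2 ≤ (x - x ^ 2) * (y - y ^ 2) := by nlinarith
  have h3 := Real.le_sqrt_of_sq_le h2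
  rw [Real.sqrt_mul hxx] at h3
  linarith
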